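/- Let G be a finite group. Then G is purely non-abelian if and only if for every group homomorphism p: Ẑ(G) → Z(G) and every bicharacter r: G → Ĝ there exists a central automorphism δ ∈ Aut_c(G) satisfying δ(x) = x · p( ρ( r(x) ∘ δ⁻¹ ) ) for all x ∈ G (i.e. δ = 1 + p(δ⁻¹)*r in the convolution notation, where all implicit restrictions of characters to the center are given by ρ). -/

import Mathlib

/-- A finite group `G` is purely non-abelian if it has no nontrivial abelian direct
factor: whenever `G` is the internal direct product of two normal subgroups `A` and `B`
with `A` abelian, `A` is trivial. -/
def PurelyNonAbelian (G : Type*) [Group G] : Prop :=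
  ∀ A B : Subgroup G, A.Normal → B.Normal → IsCompl A B →
    (∀ a b : A, a * b = b * a) → A = ⊥

section Helpers

theorem pna_idem {M : Type*} [Monoid M] [Finite M] (e : M) :
    ∃ n : ℕ, 0 < n ∧ e ^ n * e ^ n = e ^ n := by
  obtain ⟨i, j, hne, hij⟩ := Finite.exists_ne_map_eq_of_infinite (fun n : ℕ => e ^ n)
  wlog hlt : i < j generalizing i j
  · exact this j i hne.symm hij.symm (by omega)
  obtain ⟨d, rfl⟩ := Nat.exists_eq_add_of_lt hlt
  have h1 : ∀ k, i ≤ k → e ^ (k + (d + 1)) = e ^ k := by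
    intro k hk
    obtain ⟨l, rfl⟩ := Nat.exists_eq_add_of_le hk
    have h0 : e ^ i = e ^ (i + d + 1) := hij
    rw [show i + l + (d + 1) = (i + d + 1) + l by ring, pow_add, ← h0, pow_add]
  have h2 : ∀ m k, i ≤ k → e ^ (k + (d + 1) * m) = e ^ k := by
    intro m
    induction m with
    | zero => intro k _; simp
    | succ m ih =>
      intro k hk
      rw [show k + (d + 1) * (m + 1) = (k + (d + 1) * m) + (d + 1) by ring,
        h1 _ (by omega), ih k hk]
  refine ⟨(d + 1) * (i + 1), by positivity, ?_⟩
  rw [← pow_add]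
  exact h2 (i + 1) _ (by nlinarith)

theorem pna_nil {G : Type*} [Group G] [Finite G] (hG : PurelyNonAbelian G)
    (b : G →* Subgroup.center G) :
    ∃ n : ℕ, ∀ x, (fun y => (b y : G))^[n] x = 1 := by
  let e : Monoid.End G := (Subgroup.center G).subtype.comp b
  have : Finite (Monoid.End G) := Finite.of_injective (fun f : Monoid.End G => (f : G → G))
    DFunLike.coe_injective
  obtain ⟨n, hpos, hn⟩ := pna_idem e
  have hit : ∀ (m : ℕ) x, (fun y => (b y : G))^[m] x = (e ^ m : Monoid.End G) x := by
    intro m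
    induction m with
    | zero => intro x; rfl
    | succ m ih => intro x; rw [Function.iterate_succ_apply, ih, pow_succ]; rfl
  have hmem : ∀ (m : ℕ) x, (e ^ (m + 1) : Monoid.End G) x ∈ Subgroup.center G := by
    intro m x
    rw [pow_succ']
    exact (b _).2
  obtain ⟨m, rfl⟩ : ∃ m, n = m + 1 := ⟨n - 1, by omega⟩
  set E : G →* G := e ^ (m + 1) with hE
  have hEE : ∀ x, E (E x) = E x := fun x => DFunLike.congr_fun hn x
  have hc : ∀ x y, y * E x = E x * y := fun x y => Subgroup.mem_center_iff.1 (hmem m x) y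
  have hbot : E.range = ⊥ := by
    refine hG E.range E.ker ?_ inferInstance ?_ ?_
    · refine ⟨?_⟩
      rintro _ ⟨x, rfl⟩ g
      exact ⟨x, by rw [hc, mul_inv_cancel_right]⟩
    · constructor
      · rw [Subgroup.disjoint_def]
        rintro _ ⟨x, rfl⟩ h
        rw [MonoidHom.mem_ker, hEE] at h
        exact h
      · rw [codisjoint_iff, eq_top_iff]
        intro x _
        have : x = E x * ((E x)⁻¹ * x) := by group
        rw [this]
        refine Subgroup.mul_mem_sup ⟨x, rfl⟩ ?_
        rw [MonoidHom.mem_ker, map_mul, map_inv, hEE, inv_mul_cancel]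
    · rintro ⟨_, x, rfl⟩ ⟨_, y, rfl⟩
      exact Subtype.ext (hc y _)
  refine ⟨m + 1, fun x => ?_⟩
  rw [hit]
  have : E x ∈ E.range := ⟨x, rfl⟩
  rw [hbot] at this
  exact this

theorem pna_key {G : Type*} [Group G] [Finite G] (hG : PurelyNonAbelian G)
    (u : G →* Subgroup.center G)
    (p : (Subgroup.center G →* ℂˣ) →* Subgroup.center G) (r : G →* (G →* ℂˣ))
    (h : ∀ x, u x = (p (((r x).comp ((Subgroup.center G).subtype.comp u)).comp
      (Subgroup.center G).subtype))⁻¹) (x : G) : u x = 1 := by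
  let _ : CommGroup (Subgroup.center G) := { (inferInstance : Group (Subgroup.center G)) with
    mul_comm := fun a b => Subtype.ext (Subgroup.mem_center_iff.1 b.2 a) }
  have hsep : ∀ g g' : Subgroup.center G, (∀ φ : Subgroup.center G →* ℂˣ, φ g = φ g') → g = g' :=
    fun g g' => (CommGroup.forall_apply_eq_apply_iff (Subgroup.center G) (M := ℂ)).1
  let D := CommGroup.monoidHomMonoidHomEquiv (Subgroup.center G) ℂ
  let q : (Subgroup.center G →* ℂˣ) → Subgroup.center G := fun χ => D (χ.comp p)
  have hq : ∀ χ ψ : Subgroup.center G →* ℂˣ, ψ (q χ) = χ (p ψ) := fun χ ψ =>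
    CommGroup.apply_monoidHomMonoidHomEquiv ℂ ψ (χ.comp p)
  let b : G →* Subgroup.center G :=
    { toFun := fun x => q ((r x).comp (Subgroup.center G).subtype)
      map_one' := by
        apply hsep
        intro φ
        rw [hq]; simp
      map_mul' := fun x y => by
        apply hsep
        intro φ
        rw [map_mul φ, hq, hq, hq]; simp }
  have h1 : ∀ (χ : Subgroup.center G →* ℂˣ) (x : G), χ (u x) = (r x (u (q χ)))⁻¹ := by
    intro χ x
    rw [h x, map_inv, ← hq]; rfl
  have h2 : ∀ (χ : Subgroup.center G →* ℂˣ) (x : G), χ (u x) = r (q χ) (u (b x)) := by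
    intro χ x
    rw [h1]
    have := h1 ((r x).comp (Subgroup.center G).subtype) (q χ)
    have h3 : (r x) (u (q χ)) = ((r (q χ)) (u (b x)))⁻¹ := this
    rw [h3, inv_inv]
  have h4 : ∀ x, u (b x) = 1 → u x = 1 := by
    intro x hx
    apply hsep
    intro φ
    rw [h2, hx]; simp
  obtain ⟨n, hn⟩ := pna_nil hG b
  have h5 : ∀ (n : ℕ) (x : G), (fun y => (b y : G))^[n] x = 1 → u x = 1 := by
    intro n
    induction n with
    | zero => intro x hx; rw [show x = 1 from hx, map_one]
    | succ n ih => intro x hx; exact h4 x (ih _ hx)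
  exact h5 n x (hn x)

theorem pna_aut {G : Type*} [Group G] [Finite G] (hG : PurelyNonAbelian G)
    (f : G →* Subgroup.center G) : ∃ δ : MulAut G, ∀ x, δ x = x * f x := by
  have hc : ∀ x y, y * (f x : G) = f x * y := fun x y => Subgroup.mem_center_iff.1 (f x).2 y
  let d : G →* G :=
    { toFun := fun x => x * f x
      map_one' := by simp
      map_mul' := fun x y => by
        simp only [map_mul, Subgroup.coe_mul]
        rw [mul_assoc, mul_assoc, ← mul_assoc y, hc x y, mul_assoc] }
  have hinj : Function.Injective d := by
    rw [injective_iff_map_eq_one]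
    intro x hx
    obtain ⟨n, hn⟩ := pna_nil hG f
    have hx' : (f x : G) = x⁻¹ := (inv_eq_of_mul_eq_one_right hx).symm
    let e : G →* G := (Subgroup.center G).subtype.comp f
    have key : ∀ n : ℕ, e^[n] x = 1 → x = 1 := by
      intro n
      induction n with
      | zero => exact id
      | succ n ih =>
        intro h
        rw [Function.iterate_succ_apply, show e x = x⁻¹ from hx', iterate_map_inv] at h
        exact ih (inv_eq_one.1 h)
    exact key n (hn x)
  exact ⟨MulEquiv.ofBijective d (Finite.injective_iff_bijective.1 hinj), fun x => rfl⟩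

theorem pna_forward {G : Type*} [Group G] [Finite G] (hG : PurelyNonAbelian G)
    (p : (Subgroup.center G →* ℂˣ) →* Subgroup.center G)
    (r : G →* (G →* ℂˣ)) :
    ∃ δ : MulAut G, (∀ g : G, δ g * g⁻¹ ∈ Subgroup.center G) ∧
      ∀ x : G, δ x = x *
        (p (((r x).comp δ.symm.toMonoidHom).comp (Subgroup.center G).subtype) : G) := by
  let _ : CommGroup (Subgroup.center G) := { (inferInstance : Group (Subgroup.center G)) with
    mul_comm := fun a b => Subtype.ext (Subgroup.mem_center_iff.1 b.2 a) }
  have : Finite (G →* Subgroup.center G) := Finite.of_injective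
    (fun f : G →* Subgroup.center G => (f : G → Subgroup.center G)) DFunLike.coe_injective
  choose δ hδ using pna_aut hG
  let P : (G →* Subgroup.center G) → G → Subgroup.center G := fun f x =>
    p (((r x).comp (δ f).symm.toMonoidHom).comp (Subgroup.center G).subtype)
  let Φ : (G →* Subgroup.center G) → (G →* Subgroup.center G) := fun f =>
    f * (MonoidHom.mk' (P f) (fun x y => by
      simp only [P, map_mul, MonoidHom.mul_comp]))⁻¹
  have hΦ : ∀ f x, Φ f x = f x * (P f x)⁻¹ := fun f x => rfl
  have hinj : Function.Injective Φ := by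
    intro f f' hff
    let u : G →* Subgroup.center G := f * f'⁻¹
    have hu : ∀ x, u x = f x * (f' x)⁻¹ := fun x => rfl
    have hD : ∀ g z, z ∈ Subgroup.center G → (δ g).symm z ∈ Subgroup.center G := by
      intro g z hz
      rw [Subgroup.mem_center_iff] at hz ⊢
      intro y
      apply (δ g).injective
      rw [map_mul, map_mul, MulEquiv.apply_symm_apply, hz]
    let D : Subgroup.center G →* Subgroup.center G :=
      ((δ f).symm.toMonoidHom.comp (Subgroup.center G).subtype).codRestrict _
        (fun z => hD f z z.2)
    have hDc : ∀ z, ((D z : Subgroup.center G) : G) = (δ f).symm z := fun z => rfl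
    let p' : (Subgroup.center G →* ℂˣ) →* Subgroup.center G :=
      MonoidHom.mk' (fun χ => p (χ.comp D)) (fun χ ψ => by rw [MonoidHom.mul_comp, map_mul])
    let r' : G →* (G →* ℂˣ) := MonoidHom.mk' (fun x => (r x).comp (δ f').symm.toMonoidHom)
      (fun x y => by rw [map_mul, MonoidHom.mul_comp])
    have hone : ∀ x, u x = 1 := by
      refine pna_key hG u p' r' ?_
      intro x
      have h1 : f x * (P f x)⁻¹ = f' x * (P f' x)⁻¹ := DFunLike.congr_fun hff x
      have h2 : u x = P f x * (P f' x)⁻¹ := by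
        rw [hu, mul_inv_eq_iff_eq_mul]
        rw [mul_inv_eq_iff_eq_mul] at h1
        rw [h1, mul_comm, mul_comm (f' x), mul_assoc]
      rw [h2]
      change p _ * (p _)⁻¹ = (p _)⁻¹
      rw [← map_inv, ← map_inv, ← map_mul]
      congr 1
      ext z : 1
      change r x ((δ f).symm z) * (r x ((δ f').symm z))⁻¹ =
        (r x ((δ f').symm (u (D z))))⁻¹
      have h3 : (z : G) = δ f' ((δ f).symm z) * u (D z) := by
        rw [hδ, hu, hDc]
        conv_lhs => rw [← (δ f).apply_symm_apply (z : G), hδ]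
        rw [mul_assoc]
        congr 1
        rw [← Subgroup.coe_mul, mul_comm (f _), mul_inv_cancel_left]
      have h4 : (δ f').symm z = (δ f).symm z * (δ f').symm (u (D z)) := by
        conv_lhs => rw [h3]
        rw [map_mul, MulEquiv.symm_apply_apply]
      rw [h4, map_mul, mul_inv, mul_inv_cancel_left]
    ext x : 1
    have := hone x
    rw [hu, mul_inv_eq_one] at this
    exact this
  obtain ⟨f, hf⟩ := Finite.surjective_of_injective hinj 1
  refine ⟨δ f, fun g => ?_, fun x => ?_⟩
  · rw [hδ, ← Subgroup.mem_center_iff.1 (f g).2 g |>.symm, mul_inv_cancel_right]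
    exact (f g).2
  · have := DFunLike.congr_fun hf x
    rw [hΦ, MonoidHom.one_apply, mul_inv_eq_one] at this
    rw [hδ, this]

theorem pna_abelian (A : Type*) [CommGroup A] [Finite A] [Nontrivial A] :
    ∃ (φ : A ≃* (A →* ℂˣ)) (Q : A →* A), ∀ s : A →* A, ∃ a,
      s (φ.symm ((φ a).comp s)) * (φ.symm ((φ a).comp s))⁻¹ ≠ Q a := by
  obtain ⟨ψ⟩ := CommGroup.monoidHom_mulEquiv_of_hasEnoughRootsOfUnity A ℂ
  have : Finite (A →* A) := Finite.of_injective (fun f : A →* A => (f : A → A))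
    DFunLike.coe_injective
  let φ := ψ.symm
  let F : (A →* A) → (A →* A) := fun s => MonoidHom.mk'
    (fun a => s (φ.symm ((φ a).comp s)) * (φ.symm ((φ a).comp s))⁻¹) (fun a b => by
      simp only [map_mul, MonoidHom.mul_comp, mul_inv]
      exact mul_mul_mul_comm _ _ _ _)
  have hF : ∀ s a, F s a = s (φ.symm ((φ a).comp s)) * (φ.symm ((φ a).comp s))⁻¹ :=
    fun s a => rfl
  have hninj : ¬ Function.Injective F := by
    intro hinj
    have : F 1 = F (MonoidHom.id A) := by
      ext a
      rw [hF, hF]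
      simp
    have h2 := hinj this
    obtain ⟨a, ha⟩ := exists_ne (1 : A)
    exact ha (DFunLike.congr_fun h2 a).symm
  have hns : ¬ Function.Surjective F := fun h => hninj (Finite.injective_iff_surjective.2 h)
  simp only [Function.Surjective, not_forall, not_exists] at hns
  obtain ⟨Q, hQ⟩ := hns
  refine ⟨φ, Q, fun s => ?_⟩
  by_contra! hcon
  exact hQ s (MonoidHom.ext hcon)

theorem pna_proj {G : Type*} [Group G] (A B : Subgroup G) (hA : A.Normal) (hB : B.Normal)
    (hAB : IsCompl A B) : ∃ π : G →* A, ∀ a : A, π a = a := by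
  have hcomm : ∀ (a : A) (b : B), Commute (A.subtype a) (B.subtype b) := fun a b =>
    Subgroup.commute_of_normal_of_disjoint A B hA hB hAB.disjoint a b a.2 b.2
  let m : A × B →* G := A.subtype.noncommCoprod B.subtype hcomm
  have hm : ∀ a b, m (a, b) = a * b := fun a b => rfl
  have hbij : Function.Bijective m := by
    constructor
    · rw [injective_iff_map_eq_one]
      rintro ⟨a, b⟩ h
      rw [hm] at h
      have h1 : (a : G) = (b : G)⁻¹ := eq_inv_of_mul_eq_one_left h
      have h2 : (a : G) = 1 := Subgroup.disjoint_def.1 hAB.disjoint a.2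
        (by rw [h1]; exact inv_mem b.2)
      have h3 : (b : G) = 1 := by rw [h2, one_mul] at h; exact h
      exact Prod.ext (Subtype.ext h2) (Subtype.ext h3)
    · intro g
      have : g ∈ A ⊔ B := by rw [hAB.sup_eq_top]; trivial
      obtain ⟨a, ha, b, hb, rfl⟩ := Subgroup.mem_sup_of_normal_left.1 this
      exact ⟨(⟨a, ha⟩, ⟨b, hb⟩), rfl⟩
  let E := MulEquiv.ofBijective m hbij
  refine ⟨(MonoidHom.fst A B).comp E.symm.toMonoidHom, fun a => ?_⟩
  have : E.symm (a : G) = (a, 1) := by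
    rw [MulEquiv.symm_apply_eq]
    change (a : G) = m (a, 1)
    rw [hm]; simp
  change (E.symm (a : G)).1 = a
  rw [this]

theorem pna_backward {G : Type*} [Group G] [Finite G]
    (H : ∀ (p : (Subgroup.center G →* ℂˣ) →* Subgroup.center G)
        (r : G →* (G →* ℂˣ)),
        ∃ δ : MulAut G, (∀ g : G, δ g * g⁻¹ ∈ Subgroup.center G) ∧
          ∀ x : G, δ x = x *
            (p (((r x).comp δ.symm.toMonoidHom).comp (Subgroup.center G).subtype) : G)) :
    PurelyNonAbelian G := by
  intro A B hA hB hAB hab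
  by_contra hne
  let _ : CommGroup A := { (inferInstance : Group A) with mul_comm := hab }
  have : Nontrivial A := (Subgroup.nontrivial_iff_ne_bot A).2 hne
  obtain ⟨φ, Q, hQ⟩ := pna_abelian A
  obtain ⟨π, hπ⟩ := pna_proj A B hA hB hAB
  have hcen : A ≤ Subgroup.center G := by
    intro a ha
    rw [Subgroup.mem_center_iff]
    intro g
    have : g ∈ A ⊔ B := by rw [hAB.sup_eq_top]; trivial
    obtain ⟨a', ha', b, hb, rfl⟩ := Subgroup.mem_sup_of_normal_left.1 this
    have h1 : a * b = b * a :=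
      Subgroup.commute_of_normal_of_disjoint A B hA hB hAB.disjoint a b ha hb
    have h2 : a' * a = a * a' := congrArg Subtype.val (hab ⟨a', ha'⟩ ⟨a, ha⟩)
    rw [mul_assoc, ← h1, ← mul_assoc, h2, mul_assoc]
  let i : A →* Subgroup.center G := Subgroup.inclusion hcen
  let p : (Subgroup.center G →* ℂˣ) →* Subgroup.center G :=
    MonoidHom.mk' (fun χ => i (Q (φ.symm (χ.comp i))))
      (fun χ ψ => by simp only [map_mul, MonoidHom.mul_comp])
  let r : G →* (G →* ℂˣ) := MonoidHom.mk' (fun x => (φ (π x)).comp π)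
      (fun x y => by simp only [map_mul, MonoidHom.mul_comp])
  obtain ⟨δ, -, hδ⟩ := H p r
  let t : A →* A := π.comp (δ.symm.toMonoidHom.comp A.subtype)
  have h1 : ∀ a : A, δ a = ((a * Q (φ.symm ((φ a).comp t)) : A) : G) := by
    intro a
    rw [hδ a]
    change (a : G) * (Q (φ.symm ((φ (π a)).comp t)) : A) = _
    rw [hπ]; rfl
  let s : A →* A := (δ.toMonoidHom.comp A.subtype).codRestrict A (fun a => by
    change δ a ∈ A
    rw [h1]; exact Subtype.mem _)
  have hs : ∀ a, ((s a : A) : G) = δ a := fun a => rfl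
  have hts : ∀ a, t (s a) = a := by
    intro a
    change π (δ.symm (δ a)) = a
    rw [MulEquiv.symm_apply_apply, hπ]
  have hsinj : Function.Injective s := Function.LeftInverse.injective hts
  have hst : ∀ a, s (t a) = a := by
    intro a
    obtain ⟨a', rfl⟩ := Finite.surjective_of_injective hsinj a
    rw [hts]
  obtain ⟨a, ha⟩ := hQ s
  apply ha
  set a' := φ.symm ((φ a).comp s) with ha'
  have h2 : s a' = a' * Q (φ.symm ((φ a').comp t)) := Subtype.ext (h1 a')
  have h3 : (φ a').comp t = φ a := by
    rw [ha', MulEquiv.apply_symm_apply]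
    ext b
    simp only [MonoidHom.comp_apply]
    rw [hst]
  rw [h2, h3, MulEquiv.symm_apply_apply, mul_comm, inv_mul_cancel_left]

end Helpers

/-- `G` is purely non-abelian iff for every homomorphism `p : Ẑ(G) → Z(G)` and every
bicharacter `r : G → Ĝ` there is a central automorphism `δ` with
`δ(x) = x · p(ρ(r(x) ∘ δ⁻¹))` for all `x`. -/
theorem purelyNonAbelian_iff_exists_central_aut (G : Type*) [Group G] [Finite G] :
    PurelyNonAbelian G ↔
      ∀ (p : (Subgroup.center G →* ℂˣ) →* Subgroup.center G)
        (r : G →* (G →* ℂˣ)),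
        ∃ δ : MulAut G, (∀ g : G, δ g * g⁻¹ ∈ Subgroup.center G) ∧
          ∀ x : G, δ x = x *
            (p (((r x).comp δ.symm.toMonoidHom).comp (Subgroup.center G).subtype) : G) := by
  exact ⟨fun hG p r => pna_forward hG p r, pna_backward⟩
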